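/- arXiv:1101.5902 — 3 statements merged into one kernel-verified Lean document; each statement's English description precedes it below -/
import Mathlib

section
/- Let n ∈ ℕ and let f : ℝ² → ℝ be a polynomial function of total degree at most n. Then there exists exactly one function F : ℝ² → ℝ that is continuous on the closed unit disk, twice continuously differentiable on the open unit disk 𝔻, and satisfies ΔF(z) = f(z) for all z ∈ 𝔻 and F(z) = 0 for all z with |z| = 1. Moreover this F agrees on the closed unit disk with a polynomial of total degree at most n + 2 of the form F(z) = (1 − z₁² − z₂²)·g(z), where g is a polynomial of total degree at most n. -/
open MeasureTheory

noncomputable section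

abbrev E2 := EuclideanSpace ℝ (Fin 2)

/-- The Laplacian `Δf = ∂²f/∂z₁² + ∂²f/∂z₂²` of a function on `ℝ²`, computed as the sum of the
second derivatives along the two coordinate axes. -/
def lap2 {F : Type*} [NormedAddCommGroup F] [NormedSpace ℝ F]
    (f : E2 → F) (z : E2) : F :=
  iteratedDeriv 2 (fun s : ℝ => f (z + s • EuclideanSpace.single (0 : Fin 2) (1 : ℝ))) 0
    + iteratedDeriv 2 (fun s : ℝ => f (z + s • EuclideanSpace.single (1 : Fin 2) (1 : ℝ))) 0

open MvPolynomial in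
theorem totalDegree_pderiv_le {σ R : Type*} [CommSemiring R] (i : σ) (p : MvPolynomial σ R) :
    (pderiv i p).totalDegree ≤ p.totalDegree - 1 := by
  rw [totalDegree, Finset.sup_le_iff]
  intro m hm
  rw [mem_support_iff, coeff_pderiv] at hm
  have h := le_totalDegree (mem_support_iff.2 (left_ne_zero_of_mul hm))
  rw [Finsupp.sum_add_index' (by simp) (by simp)] at h
  simp only [Finsupp.sum_single_index] at h
  lia

/-- The Laplacian of a polynomial in two variables. -/
def polyLaplacian : MvPolynomial (Fin 2) ℝ →ₗ[ℝ] MvPolynomial (Fin 2) ℝ :=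
  (MvPolynomial.pderiv 0).toLinearMap ∘ₗ (MvPolynomial.pderiv 0).toLinearMap
    + (MvPolynomial.pderiv 1).toLinearMap ∘ₗ (MvPolynomial.pderiv 1).toLinearMap

open MvPolynomial in
theorem polyLaplacian_apply (p : MvPolynomial (Fin 2) ℝ) :
    polyLaplacian p = pderiv 0 (pderiv 0 p) + pderiv 1 (pderiv 1 p) := rfl

theorem totalDegree_polyLaplacian_le (p : MvPolynomial (Fin 2) ℝ) :
    (polyLaplacian p).totalDegree ≤ p.totalDegree - 2 := by
  have h (i : Fin 2) : (MvPolynomial.pderiv i (MvPolynomial.pderiv i p)).totalDegree ≤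
      p.totalDegree - 2 :=
    (totalDegree_pderiv_le i _).trans (by have := totalDegree_pderiv_le i p; lia)
  exact (MvPolynomial.totalDegree_add _ _).trans (max_le (h 0) (h 1))

theorem contDiff_eval (p : MvPolynomial (Fin 2) ℝ) {k : WithTop ℕ∞} :
    ContDiff ℝ k (fun z : E2 => MvPolynomial.eval (fun i => z i) p) := by
  induction p using MvPolynomial.induction_on with
  | C a => simpa using contDiff_const
  | add p q hp hq => simpa using hp.add hq
  | mul_X p i hp =>
    have hi : ContDiff ℝ k (fun z : E2 => z i) := by fun_prop
    simpa using hp.mul hi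

theorem hasDerivAt_eval_line (p : MvPolynomial (Fin 2) ℝ) (i : Fin 2) (z : E2) (s : ℝ) :
    HasDerivAt (fun s : ℝ => MvPolynomial.eval
        (fun j => (z + s • EuclideanSpace.single i (1 : ℝ) : E2) j) p)
      (MvPolynomial.eval (fun j => (z + s • EuclideanSpace.single i (1 : ℝ) : E2) j)
        (MvPolynomial.pderiv i p)) s := by
  induction p using MvPolynomial.induction_on with
  | C a => simpa using hasDerivAt_const s a
  | add p q hp hq =>
    simp only [map_add]
    exact hp.add hq
  | mul_X p j hp =>
    have hj : HasDerivAt (fun s : ℝ => (z + s • EuclideanSpace.single i (1 : ℝ) : E2) j)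
        ((Pi.single i 1 : Fin 2 → ℝ) j) s := by
      simpa [Pi.single_apply] using
        ((hasDerivAt_id s).mul_const ((Pi.single i 1 : Fin 2 → ℝ) j)).const_add (z j)
    simp only [map_mul, MvPolynomial.eval_X]
    refine (hp.mul hj).congr_deriv ?_
    rw [MvPolynomial.pderiv_mul, MvPolynomial.pderiv_X]
    simp only [map_add, map_mul, MvPolynomial.eval_X, Pi.single_apply]
    split_ifs <;> simp_all

theorem lap2_eval (p : MvPolynomial (Fin 2) ℝ) (z : E2) :
    lap2 (fun z : E2 => MvPolynomial.eval (fun i => z i) p) z =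
      MvPolynomial.eval (fun i => z i) (polyLaplacian p) := by
  have h (q : MvPolynomial (Fin 2) ℝ) (i : Fin 2) := funext fun s =>
    (hasDerivAt_eval_line q i z s).deriv
  simp only [lap2, iteratedDeriv_succ, iteratedDeriv_zero, h, polyLaplacian_apply]
  simp

theorem contDiffAt_line {u : E2 → ℝ} {z : E2} {k : WithTop ℕ∞} (hu : ContDiffAt ℝ k u z) (v : E2) :
    ContDiffAt ℝ k (fun s : ℝ => u (z + s • v)) 0 := by
  refine ContDiffAt.comp (g := u) (0 : ℝ) (by simpa using hu) ?_
  fun_prop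

theorem lap2_add {u v : E2 → ℝ} {z : E2} (hu : ContDiffAt ℝ 2 u z) (hv : ContDiffAt ℝ 2 v z) :
    lap2 (fun z => u z + v z) z = lap2 u z + lap2 v z := by
  simp only [lap2]
  rw [iteratedDeriv_fun_add (contDiffAt_line hu _) (contDiffAt_line hv _),
    iteratedDeriv_fun_add (contDiffAt_line hu _) (contDiffAt_line hv _)]
  ring

theorem lap2_neg (u : E2 → ℝ) (z : E2) : lap2 (fun z => -u z) z = -lap2 u z := by
  simp only [lap2, iteratedDeriv_fun_neg]
  ring

theorem IsLocalMax.deriv_deriv_nonpos {φ : ℝ → ℝ} {x : ℝ} (h : IsLocalMax φ x)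
    (hc : ContinuousAt φ x) : deriv (deriv φ) x ≤ 0 := by
  by_contra! hpos
  have hmin := isLocalMin_of_deriv_deriv_pos hpos h.deriv_eq_zero hc
  have hconst : φ =ᶠ[nhds x] fun _ => φ x := by
    filter_upwards [h, hmin] with y hy hy' using le_antisymm hy hy'
  have := hconst.deriv.deriv_eq
  simp only [deriv_const'] at this
  exact hpos.ne' this

theorem IsLocalMax.lap2_nonpos {u : E2 → ℝ} {z : E2} (h : IsLocalMax u z)
    (hu : ContDiffAt ℝ 2 u z) : lap2 u z ≤ 0 := by
  have key (v : E2) : iteratedDeriv 2 (fun s : ℝ => u (z + s • v)) 0 ≤ 0 := by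
    rw [iteratedDeriv_succ, iteratedDeriv_one]
    refine IsLocalMax.deriv_deriv_nonpos ?_ (contDiffAt_line hu v).continuousAt
    have hline : Filter.Tendsto (fun s : ℝ => z + s • v) (nhds 0) (nhds z) := by
      have : Continuous (fun s : ℝ => z + s • v) := by fun_prop
      simpa using this.tendsto 0
    have := hline.eventually h
    simpa [IsLocalMax, IsMaxFilter] using this
  exact add_nonpos (key _) (key _)

theorem nonpos_of_lap2_pos {u : E2 → ℝ} (hc : ContinuousOn u (Metric.closedBall 0 1))
    (hd : ContDiffOn ℝ 2 u (Metric.ball 0 1)) (hl : ∀ z ∈ Metric.ball (0 : E2) 1, 0 < lap2 u z)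
    (hb : ∀ z : E2, ‖z‖ = 1 → u z ≤ 0) : ∀ z ∈ Metric.closedBall (0 : E2) 1, u z ≤ 0 := by
  obtain ⟨x, hx, hmax⟩ := (isCompact_closedBall (0 : E2) 1).exists_isMaxOn ⟨0, by simp⟩ hc
  have hx1 : ‖x‖ = 1 := by
    by_contra hne
    have hxb : x ∈ Metric.ball (0 : E2) 1 :=
      mem_ball_zero_iff.2 (lt_of_le_of_ne (mem_closedBall_zero_iff.1 hx) hne)
    have hn := Metric.isOpen_ball.mem_nhds hxb
    have hloc : IsLocalMax u x :=
      hmax.isLocalMax (Filter.mem_of_superset hn Metric.ball_subset_closedBall)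
    exact (hloc.lap2_nonpos (hd.contDiffAt hn)).not_gt (hl x hxb)
  exact fun z hz => (hmax hz).trans (hb x hx1)

theorem norm_sq_eq_coords (z : E2) : ‖z‖ ^ 2 = z 0 ^ 2 + z 1 ^ 2 := by
  simp [EuclideanSpace.norm_sq_eq]

open MvPolynomial in
theorem nonpos_of_lap2_eq_zero {u : E2 → ℝ} (hc : ContinuousOn u (Metric.closedBall 0 1))
    (hd : ContDiffOn ℝ 2 u (Metric.ball 0 1)) (hl : ∀ z ∈ Metric.ball (0 : E2) 1, lap2 u z = 0)
    (hb : ∀ z : E2, ‖z‖ = 1 → u z = 0) : ∀ z ∈ Metric.closedBall (0 : E2) 1, u z ≤ 0 := by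
  intro z hz
  refine le_of_forall_pos_le_add fun ε hε => ?_
  let q : MvPolynomial (Fin 2) ℝ := C ε * (X 0 * X 0 + X 1 * X 1 - 1)
  have hq (z : E2) : eval (fun i => z i) q = ε * (‖z‖ ^ 2 - 1) := by
    simp [q, norm_sq_eq_coords, ← sq]
  have hlq (z : E2) : eval (fun i => z i) (polyLaplacian q) = 4 * ε := by
    simp [q, polyLaplacian_apply]
    ring
  have h := nonpos_of_lap2_pos (u := fun z => u z + eval (fun i => z i) q)
    (hc.add (contDiff_eval q (k := 0)).continuous.continuousOn)
    (hd.add (contDiff_eval q).contDiffOn)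
    (fun z hz => by
      rw [lap2_add (hd.contDiffAt (Metric.isOpen_ball.mem_nhds hz)) (contDiff_eval q).contDiffAt,
        lap2_eval, hl z hz, hlq]
      positivity)
    (fun z hz => by rw [hb z hz, hq, hz]; simp) z hz
  rw [hq] at h
  nlinarith [sq_nonneg ‖z‖]

theorem eq_of_lap2_eq {u v : E2 → ℝ} (huc : ContinuousOn u (Metric.closedBall 0 1))
    (hvc : ContinuousOn v (Metric.closedBall 0 1)) (hud : ContDiffOn ℝ 2 u (Metric.ball 0 1))
    (hvd : ContDiffOn ℝ 2 v (Metric.ball 0 1))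
    (hl : ∀ z ∈ Metric.ball (0 : E2) 1, lap2 u z = lap2 v z)
    (hb : ∀ z : E2, ‖z‖ = 1 → u z = v z) : ∀ z ∈ Metric.closedBall (0 : E2) 1, u z = v z := by
  have key {u v : E2 → ℝ} (huc : ContinuousOn u (Metric.closedBall 0 1))
      (hvc : ContinuousOn v (Metric.closedBall 0 1)) (hud : ContDiffOn ℝ 2 u (Metric.ball 0 1))
      (hvd : ContDiffOn ℝ 2 v (Metric.ball 0 1))
      (hl : ∀ z ∈ Metric.ball (0 : E2) 1, lap2 u z = lap2 v z)
      (hb : ∀ z : E2, ‖z‖ = 1 → u z = v z) (z : E2) (hz : z ∈ Metric.closedBall (0 : E2) 1) :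
      u z ≤ v z := by
    have := nonpos_of_lap2_eq_zero (u := fun z => u z + -v z) (huc.add hvc.neg) (hud.add hvd.neg)
      (fun z hz => by
        have hn := Metric.isOpen_ball.mem_nhds hz
        rw [lap2_add (hud.contDiffAt hn) (hvd.contDiffAt hn).neg, lap2_neg, hl z hz,
          add_neg_cancel])
      (fun z hz => by rw [hb z hz, add_neg_cancel]) z hz
    linarith
  exact fun z hz => le_antisymm (key huc hvc hud hvd hl hb z hz)
    (key hvc huc hvd hud (fun z hz => (hl z hz).symm) (fun z hz => (hb z hz).symm) z hz)

theorem eq_zero_of_eval_ball {p : MvPolynomial (Fin 2) ℝ}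
    (h : ∀ z ∈ Metric.ball (0 : E2) 1, MvPolynomial.eval (fun i => z i) p = 0) : p = 0 := by
  refine MvPolynomial.funext_set (fun _ => Set.Ioo (0 : ℝ) (1 / 2))
    (fun _ => Set.Ioo_infinite (by norm_num)) fun x hx => ?_
  have h0 := hx 0 trivial
  have h1 := hx 1 trivial
  simp only [Set.mem_Ioo] at h0 h1
  have hn := norm_sq_eq_coords (WithLp.toLp 2 x)
  dsimp only at hn
  refine (h (WithLp.toLp 2 x) (mem_ball_zero_iff.2 ?_)).trans (map_zero _).symm
  nlinarith [norm_nonneg (WithLp.toLp 2 x)]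

/-- The polynomial `1 - z₁² - z₂²`, which vanishes on the unit circle. -/
def diskPoly : MvPolynomial (Fin 2) ℝ := 1 - MvPolynomial.X 0 ^ 2 - MvPolynomial.X 1 ^ 2

theorem eval_diskPoly (z : E2) :
    MvPolynomial.eval (fun i => z i) diskPoly = 1 - z 0 ^ 2 - z 1 ^ 2 := by
  simp [diskPoly]

open MvPolynomial in
theorem totalDegree_diskPoly_le : diskPoly.totalDegree ≤ 2 := by
  refine (totalDegree_sub _ _).trans (max_le ((totalDegree_sub _ _).trans (max_le ?_ ?_)) ?_) <;>
    simp [totalDegree_X_pow]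

theorem eval_diskPoly_mul_eq_zero (g : MvPolynomial (Fin 2) ℝ) {z : E2} (hz : ‖z‖ = 1) :
    MvPolynomial.eval (fun i => z i) (diskPoly * g) = 0 := by
  have h := norm_sq_eq_coords z
  rw [hz] at h
  rw [map_mul, eval_diskPoly, show 1 - z 0 ^ 2 - z 1 ^ 2 = 0 by linarith, zero_mul]

theorem eq_zero_of_polyLaplacian_diskPoly_mul_eq_zero {g : MvPolynomial (Fin 2) ℝ}
    (hg : polyLaplacian (diskPoly * g) = 0) : g = 0 := by
  have h := eq_of_lap2_eq (u := fun z : E2 => MvPolynomial.eval (fun i => z i) (diskPoly * g))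
    (v := fun z : E2 => MvPolynomial.eval (fun i => z i) (0 : MvPolynomial (Fin 2) ℝ))
    (contDiff_eval _ (k := 0)).continuous.continuousOn
    (contDiff_eval _ (k := 0)).continuous.continuousOn
    (contDiff_eval _).contDiffOn (contDiff_eval _).contDiffOn
    (fun z _ => by rw [lap2_eval, lap2_eval, hg, map_zero, map_zero, map_zero])
    (fun z hz => by rw [eval_diskPoly_mul_eq_zero g hz, map_zero])
  refine eq_zero_of_eval_ball fun z hz => ?_
  have hz' := h z (Metric.ball_subset_closedBall hz)
  rw [map_zero, map_mul, eval_diskPoly] at hz'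
  refine (mul_eq_zero.1 hz').resolve_left ?_
  have hn := norm_sq_eq_coords z
  rw [mem_ball_zero_iff] at hz
  nlinarith [norm_nonneg z]

open MvPolynomial in
theorem exists_polyLaplacian_diskPoly_mul_eq {n : ℕ} {p : MvPolynomial (Fin 2) ℝ}
    (hp : p.totalDegree ≤ n) :
    ∃ g : MvPolynomial (Fin 2) ℝ, g.totalDegree ≤ n ∧ polyLaplacian (diskPoly * g) = p := by
  let L : MvPolynomial (Fin 2) ℝ →ₗ[ℝ] MvPolynomial (Fin 2) ℝ :=
    polyLaplacian ∘ₗ LinearMap.mulLeft ℝ diskPoly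
  have hL : ∀ g ∈ restrictTotalDegree (Fin 2) ℝ n, L g ∈ restrictTotalDegree (Fin 2) ℝ n := by
    intro g hg
    rw [mem_restrictTotalDegree] at hg ⊢
    have h₁ := totalDegree_polyLaplacian_le (diskPoly * g)
    have h₂ := totalDegree_mul diskPoly g
    have h₃ := totalDegree_diskPoly_le
    change (polyLaplacian (diskPoly * g)).totalDegree ≤ n
    lia
  have hinj : Function.Injective (L.restrict hL) := by
    refine (injective_iff_map_eq_zero _).2 fun g hg => Subtype.ext ?_
    exact eq_zero_of_polyLaplacian_diskPoly_mul_eq_zero (congrArg Subtype.val hg)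
  obtain ⟨g, hg⟩ := LinearMap.surjective_of_injective hinj
    ⟨p, (mem_restrictTotalDegree _ _ _).2 hp⟩
  exact ⟨g, (mem_restrictTotalDegree _ _ _).1 g.2, congrArg Subtype.val hg⟩

/-- For a polynomial right-hand side `f` of total degree at most `n`, the
Dirichlet problem `ΔF = f` on the unit disk with zero boundary values has a solution, unique on
the closed unit disk, and the solution agrees on the closed disk with a polynomial of the form
`(1 − z₁² − z₂²)·g(z)` with `g` of total degree at most `n` (hence of degree at most `n+2`). -/
theorem dirichlet_problem_unit_disk_polynomial
    (n : ℕ) (f : E2 → ℝ)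
    (hf : ∃ p : MvPolynomial (Fin 2) ℝ, p.totalDegree ≤ n ∧
      ∀ z : E2, f z = MvPolynomial.eval (fun i => z i) p) :
    ∃ F : E2 → ℝ,
      (ContinuousOn F (Metric.closedBall 0 1) ∧ ContDiffOn ℝ 2 F (Metric.ball 0 1) ∧
        (∀ z ∈ Metric.ball (0 : E2) 1, lap2 F z = f z) ∧
        (∀ z : E2, ‖z‖ = 1 → F z = 0)) ∧
      (∀ F' : E2 → ℝ,
        (ContinuousOn F' (Metric.closedBall 0 1) ∧ ContDiffOn ℝ 2 F' (Metric.ball 0 1) ∧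
          (∀ z ∈ Metric.ball (0 : E2) 1, lap2 F' z = f z) ∧
          (∀ z : E2, ‖z‖ = 1 → F' z = 0)) →
        ∀ z ∈ Metric.closedBall (0 : E2) 1, F' z = F z) ∧
      (∃ g : MvPolynomial (Fin 2) ℝ, g.totalDegree ≤ n ∧
        ∀ z ∈ Metric.closedBall (0 : E2) 1,
          F z = (1 - (z 0) ^ 2 - (z 1) ^ 2) * MvPolynomial.eval (fun i => z i) g) := by
  obtain ⟨p, hp, hfp⟩ := hf
  obtain ⟨g, hg, hgp⟩ := exists_polyLaplacian_diskPoly_mul_eq hp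
  have hc := (contDiff_eval (diskPoly * g) (k := 0)).continuous.continuousOn
    (s := Metric.closedBall 0 1)
  have hd := (contDiff_eval (diskPoly * g) (k := 2)).contDiffOn (s := Metric.ball 0 1)
  have hl (z : E2) : lap2 (fun z : E2 => MvPolynomial.eval (fun i => z i) (diskPoly * g)) z
      = f z := by
    rw [lap2_eval, hgp, hfp]
  refine ⟨fun z => MvPolynomial.eval (fun i => z i) (diskPoly * g),
    ⟨hc, hd, fun z _ => hl z, fun z => eval_diskPoly_mul_eq_zero g⟩, ?_, g, hg, fun z _ => ?_⟩
  · rintro F' ⟨hc', hd', hl', hb'⟩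
    exact eq_of_lap2_eq hc' hc hd' hd (fun z hz => (hl' z hz).trans (hl z).symm)
      fun z hz => (hb' z hz).trans (eval_diskPoly_mul_eq_zero g hz).symm
  · simp only [map_mul, eval_diskPoly]

end
end

section
/- Fix an integer n ≥ 1 and let Hₙ denote the space of real homogeneous polynomials of degree n in two variables z₁, z₂. Then the linear map T : Hₙ → Hₙ defined by T(g)(z) = −4(n+1)·g(z) − (z₁² + z₂²)·Δg(z) is a bijection. Equivalently, for every homogeneous polynomial f* of degree n there exists a unique homogeneous polynomial gₙ of degree n such that the degree-n homogeneous component of Δ((1 − z₁² − z₂²)·gₙ) equals f*. -/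
open MvPolynomial

noncomputable section

/-- The formal Laplacian `Δp = ∂²p/∂z₁² + ∂²p/∂z₂²` of a polynomial in two variables. -/
def plap (p : MvPolynomial (Fin 2) ℝ) : MvPolynomial (Fin 2) ℝ :=
  pderiv 0 (pderiv 0 p) + pderiv 1 (pderiv 1 p)

/-- Commuting the Laplacian past multiplication by `z₁² + z₂²` on homogeneous polynomials. -/
theorem plap_sq_mul {m : ℕ} {h : MvPolynomial (Fin 2) ℝ} (hh : h.IsHomogeneous m) :
    plap ((X 0 ^ 2 + X 1 ^ 2) * h) =
      (4 * ((m : ℝ) + 1)) • h + (X 0 ^ 2 + X 1 ^ 2) * plap h := by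
  have euler := hh.sum_X_mul_pderiv
  rw [Fin.sum_univ_two, nsmul_eq_mul] at euler
  have h01 : pderiv (0 : Fin 2) (X 1 : MvPolynomial (Fin 2) ℝ) = 0 :=
    pderiv_X_of_ne (by decide)
  have h10 : pderiv (1 : Fin 2) (X 0 : MvPolynomial (Fin 2) ℝ) = 0 :=
    pderiv_X_of_ne (by decide)
  simp only [plap, pderiv_mul, map_add, pow_two, pderiv_X_self, h01, h10, smul_eq_C_mul,
    map_mul, map_one, pderiv_one, map_zero, map_natCast]
  rw [show (C (4 : ℝ) : MvPolynomial (Fin 2) ℝ) = 4 from map_ofNat C 4]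
  linear_combination 4 * euler

theorem plap_sub (p q : MvPolynomial (Fin 2) ℝ) : plap (p - q) = plap p - plap q := by
  simp only [plap, map_sub]; ring

theorem plap_smul (c : ℝ) (p : MvPolynomial (Fin 2) ℝ) : plap (c • p) = c • plap p := by
  simp only [plap, Derivation.map_smul, smul_add]

theorem isHomogeneous_plap {n : ℕ} {g : MvPolynomial (Fin 2) ℝ} (hg : g.IsHomogeneous n) :
    (plap g).IsHomogeneous (n - 2) :=
  hg.pderiv.pderiv.add hg.pderiv.pderiv

theorem plap_eq_zero_of_lt_two {n : ℕ} (hn : n < 2) {g : MvPolynomial (Fin 2) ℝ}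
    (hg : g.IsHomogeneous n) : plap g = 0 := by
  have key (i : Fin 2) : pderiv i (pderiv i g) = 0 := by
    have h0 : (pderiv i g).IsHomogeneous 0 := by
      have h1 := hg.pderiv (i := i)
      rwa [show n - 1 = 0 by omega] at h1
    rw [totalDegree_eq_zero_iff_eq_C.mp (Nat.le_zero.mp h0.totalDegree_le), pderiv_C]
  simp [plap, key]

theorem isHomogeneous_X_sq_add_X_sq :
    (X 0 ^ 2 + X 1 ^ 2 : MvPolynomial (Fin 2) ℝ).IsHomogeneous 2 :=
  (isHomogeneous_X_pow 0 2).add (isHomogeneous_X_pow 1 2)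

theorem isHomogeneous_sq_mul_plap {n : ℕ} {g : MvPolynomial (Fin 2) ℝ}
    (hg : g.IsHomogeneous n) : ((X 0 ^ 2 + X 1 ^ 2) * plap g).IsHomogeneous n := by
  by_cases hn : n < 2
  · rw [plap_eq_zero_of_lt_two hn hg, mul_zero]
    exact isHomogeneous_zero _ _ _
  · have h := isHomogeneous_X_sq_add_X_sq.mul (isHomogeneous_plap hg)
    rwa [show 2 + (n - 2) = n by omega] at h

theorem isHomogeneous_smul {n : ℕ} {g : MvPolynomial (Fin 2) ℝ} (c : ℝ)
    (hg : g.IsHomogeneous n) : (c • g).IsHomogeneous n :=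
  (homogeneousSubmodule (Fin 2) ℝ n).smul_mem c hg

theorem eq_zero_of_smul_add_sq_mul_plap_eq_zero (n : ℕ) {c : ℝ} (hc : 0 < c)
    {g : MvPolynomial (Fin 2) ℝ} (hg : g.IsHomogeneous n)
    (h : c • g + (X 0 ^ 2 + X 1 ^ 2) * plap g = 0) : g = 0 := by
  induction n using Nat.strong_induction_on generalizing c g with
  | _ n ih =>
    suffices hp : plap g = 0 by
      simpa [hp, hc.ne'] using h
    by_cases hn : n < 2
    · exact plap_eq_zero_of_lt_two hn hg
    · have hL := isHomogeneous_plap hg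
      refine ih (n - 2) (by omega) (c := c + 4 * (((n - 2 : ℕ) : ℝ) + 1)) (by positivity) hL ?_
      have h1 : plap (c • g + (X 0 ^ 2 + X 1 ^ 2) * plap g) = 0 := by
        rw [h]; simp [plap]
      have h2 : plap (c • g + (X 0 ^ 2 + X 1 ^ 2) * plap g) =
          plap (c • g) + plap ((X 0 ^ 2 + X 1 ^ 2) * plap g) := by
        simp only [plap, map_add]; ring
      rw [h2, plap_smul, plap_sq_mul hL] at h1
      rw [add_smul, add_assoc, h1]

theorem exists_smul_add_sq_mul_plap_eq (n : ℕ) {c : ℝ} (hc : 0 < c)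
    {f : MvPolynomial (Fin 2) ℝ} (hf : f.IsHomogeneous n) :
    ∃ g : MvPolynomial (Fin 2) ℝ, g.IsHomogeneous n ∧
      c • g + (X 0 ^ 2 + X 1 ^ 2) * plap g = f := by
  induction n using Nat.strong_induction_on generalizing c f with
  | _ n ih =>
    by_cases hn : n < 2
    · refine ⟨c⁻¹ • f, isHomogeneous_smul _ hf, ?_⟩
      rw [plap_smul, plap_eq_zero_of_lt_two hn hf, smul_inv_smul₀ hc.ne']
      simp
    · obtain ⟨h, hh, he⟩ := ih (n - 2) (by omega)
        (c := c + 4 * (((n - 2 : ℕ) : ℝ) + 1)) (by positivity) (isHomogeneous_plap hf)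
      have hr := isHomogeneous_X_sq_add_X_sq.mul hh
      rw [show 2 + (n - 2) = n by omega] at hr
      refine ⟨c⁻¹ • (f - (X 0 ^ 2 + X 1 ^ 2) * h), isHomogeneous_smul _ (hf.sub hr), ?_⟩
      have hd : plap f - plap ((X 0 ^ 2 + X 1 ^ 2) * h) = c • h := by
        rw [plap_sq_mul hh, ← he, add_smul]; ring
      rw [plap_smul, plap_sub, hd, smul_inv_smul₀ hc.ne', inv_smul_smul₀ hc.ne']
      ring

theorem existsUnique_smul_sub_sq_mul_plap_eq (n : ℕ) {c : ℝ} (hc : 0 < c)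
    {f : MvPolynomial (Fin 2) ℝ} (hf : f.IsHomogeneous n) :
    ∃! g : MvPolynomial (Fin 2) ℝ, g.IsHomogeneous n ∧
      (-c) • g - (X 0 ^ 2 + X 1 ^ 2) * plap g = f := by
  have hneg (g : MvPolynomial (Fin 2) ℝ) : (-c) • g - (X 0 ^ 2 + X 1 ^ 2) * plap g =
      -(c • g + (X 0 ^ 2 + X 1 ^ 2) * plap g) := by
    rw [neg_smul]; ring
  simp only [hneg]
  obtain ⟨g, hg, he⟩ := exists_smul_add_sq_mul_plap_eq n hc hf.neg
  refine ⟨g, ⟨hg, by rw [he, neg_neg]⟩, fun g' ⟨hg', he'⟩ => ?_⟩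
  refine sub_eq_zero.mp (eq_zero_of_smul_add_sq_mul_plap_eq_zero n hc (hg'.sub hg) ?_)
  rw [smul_sub, plap_sub]
  linear_combination -he' - he

theorem homogeneousComponent_plap_one_sub_sq_mul {n : ℕ} (hn : 1 ≤ n)
    {g : MvPolynomial (Fin 2) ℝ} (hg : g.IsHomogeneous n) :
    homogeneousComponent n (plap ((1 - X 0 ^ 2 - X 1 ^ 2) * g)) =
      (-(4 * ((n : ℝ) + 1))) • g - (X 0 ^ 2 + X 1 ^ 2) * plap g := by
  have hT : ((4 * ((n : ℝ) + 1)) • g + (X 0 ^ 2 + X 1 ^ 2) * plap g).IsHomogeneous n :=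
    (isHomogeneous_smul _ hg).add (isHomogeneous_sq_mul_plap hg)
  rw [show (1 - X 0 ^ 2 - X 1 ^ 2) * g = g - (X 0 ^ 2 + X 1 ^ 2) * g by ring, plap_sub,
    plap_sq_mul hg, map_sub, homogeneousComponent_of_mem (isHomogeneous_plap hg),
    homogeneousComponent_of_mem hT, if_neg (by omega), if_pos rfl, neg_smul]
  ring

/-- On the space `Hₙ` of homogeneous polynomials of degree `n ≥ 1` in two
variables, the map `T(g) = −4(n+1)·g − (z₁² + z₂²)·Δg` is a bijection; equivalently, every
homogeneous `f*` of degree `n` is the degree-`n` homogeneous component of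
`Δ((1 − z₁² − z₂²)·gₙ)` for a unique homogeneous `gₙ` of degree `n`. -/
theorem homogeneous_leading_term_bijective
    (n : ℕ) (hn : 1 ≤ n) :
    (∀ g : MvPolynomial (Fin 2) ℝ, g.IsHomogeneous n →
      ((-(4 * ((n : ℝ) + 1))) • g - (X 0 ^ 2 + X 1 ^ 2) * plap g).IsHomogeneous n) ∧
    (∀ f : MvPolynomial (Fin 2) ℝ, f.IsHomogeneous n →
      ∃! g : MvPolynomial (Fin 2) ℝ, g.IsHomogeneous n ∧
        (-(4 * ((n : ℝ) + 1))) • g - (X 0 ^ 2 + X 1 ^ 2) * plap g = f) ∧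
    (∀ f : MvPolynomial (Fin 2) ℝ, f.IsHomogeneous n →
      ∃! g : MvPolynomial (Fin 2) ℝ, g.IsHomogeneous n ∧
        homogeneousComponent n (plap ((1 - X 0 ^ 2 - X 1 ^ 2) * g)) = f) := by
  have hc : 0 < 4 * ((n : ℝ) + 1) := by positivity
  refine ⟨fun g hg => (isHomogeneous_smul _ hg).sub (isHomogeneous_sq_mul_plap hg),
    fun f hf => existsUnique_smul_sub_sq_mul_plap_eq n hc hf, fun f hf => ?_⟩
  refine (existsUnique_congr fun g => and_congr_right fun hg => ?_).mpr
    (existsUnique_smul_sub_sq_mul_plap_eq n hc hf)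
  rw [homogeneousComponent_plap_one_sub_sq_mul hn hg]

end
end

section
/- Define functions fₙ : ℝ → ℝ for n ∈ ℕ by f₀(x) = 1, f₁(x) = 0, and fₙ(x) = (1/(2·n!))·(1 − x²)·((1 − x)^{n−1} − (−1 − x)^{n−1}) for n ≥ 2. Then for every n ≥ 2 and every x ∈ ℝ: fₙ''(x) = −f_{n−2}(x) − 2·f_{n−1}'(x), and fₙ(1) = fₙ(−1) = 0. -/
noncomputable section

/-- The `n`-th term of the expected signature of one-dimensional Brownian motion started at
`x` and stopped at the first exit of `[−1, 1]`:  `f₀ = 1`, `f₁ = 0` and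
`fₙ(x) = (1/(2·n!))·(1 − x²)·((1 − x)^(n−1) − (−1 − x)^(n−1))` for `n ≥ 2`. -/
def oneDimSig : ℕ → ℝ → ℝ
  | 0, _ => 1
  | 1, _ => 0
  | (n + 2), x =>
      (1 / (2 * (Nat.factorial (n + 2) : ℝ))) * (1 - x ^ 2)
        * ((1 - x) ^ (n + 1) - (-1 - x) ^ (n + 1))

open Nat in
theorem oneDimSig_eq (n : ℕ) (x : ℝ) :
    oneDimSig n x = ((1 - x) * (-1 - x) ^ n - (-1 - x) * (1 - x) ^ n) / (2 * n !) := by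
  match n with
  | 0 => simp only [oneDimSig, pow_zero, factorial_zero]; norm_num
  | 1 => simp only [oneDimSig]; ring
  | n + 2 => simp only [oneDimSig]; ring

theorem hasDerivAt_const_sub_pow_succ (c : ℝ) (n : ℕ) (x : ℝ) :
    HasDerivAt (fun y : ℝ => (c - y) ^ (n + 1)) (-((n + 1) * (c - x) ^ n)) x := by
  refine (((hasDerivAt_id x).const_sub c).pow (n + 1)).congr_deriv ?_
  simp

open Nat in
theorem hasDerivAt_oneDimSig_succ (n : ℕ) (x : ℝ) :
    HasDerivAt (oneDimSig (n + 1))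
      (((1 - x) ^ (n + 1) - (-1 - x) ^ (n + 1)
        + (n + 1) * ((-1 - x) * (1 - x) ^ n - (1 - x) * (-1 - x) ^ n)) / (2 * (n + 1)!)) x := by
  rw [funext (oneDimSig_eq (n + 1))]
  have ha := (hasDerivAt_id x).const_sub 1
  have hb := (hasDerivAt_id x).const_sub (-1)
  refine (((ha.mul (hasDerivAt_const_sub_pow_succ (-1) n x)).sub
    (hb.mul (hasDerivAt_const_sub_pow_succ 1 n x))).div_const (2 * ((n + 1)! : ℝ))).congr_deriv ?_
  simp only [id]
  ring

open Nat in
theorem hasDerivAt_deriv_oneDimSig_add_two (n : ℕ) (x : ℝ) :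
    HasDerivAt (deriv (oneDimSig (n + 2)))
      (-oneDimSig n x - 2 * deriv (oneDimSig (n + 1)) x) x := by
  have hderiv : deriv (oneDimSig (n + 2)) = _ :=
    funext fun y => (hasDerivAt_oneDimSig_succ (n + 1) y).deriv
  rw [hderiv, (hasDerivAt_oneDimSig_succ n x).deriv, oneDimSig_eq]
  have ha := (hasDerivAt_id x).const_sub 1
  have hb := (hasDerivAt_id x).const_sub (-1)
  have hpa := hasDerivAt_const_sub_pow_succ 1
  have hpb := hasDerivAt_const_sub_pow_succ (-1)
  refine ((((hpa (n + 1) x).sub (hpb (n + 1) x)).add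
    (((hb.mul (hpa n x)).sub (ha.mul (hpb n x))).const_mul (((n + 1 : ℕ) : ℝ) + 1))).div_const
      (2 * ((n + 1 + 1)! : ℝ))).congr_deriv ?_
  have h : (n ! : ℝ) ≠ 0 := by positivity
  simp only [id, factorial_succ]
  push_cast
  field_simp
  ring

/-- The family `fₙ` satisfies the second-order ODE
`fₙ'' = −f_{n−2} − 2·f_{n−1}'` on `ℝ` for `n ≥ 2`, together with the boundary conditions
`fₙ(1) = fₙ(−1) = 0`. -/
theorem oneDimSig_ode (n : ℕ) (hn : 2 ≤ n) :
    (∀ x : ℝ, deriv (deriv (oneDimSig n)) x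
        = -oneDimSig (n - 2) x - 2 * deriv (oneDimSig (n - 1)) x) ∧
      oneDimSig n 1 = 0 ∧ oneDimSig n (-1) = 0 := by
  obtain ⟨n, rfl⟩ := Nat.exists_eq_add_of_le' hn
  refine ⟨fun x => (hasDerivAt_deriv_oneDimSig_add_two n x).deriv, ?_, ?_⟩ <;> simp [oneDimSig]

end
end
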